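/- Let Ω = {θ_n}_{n≥1} ⊂ (0, π/2] be a lacunary sequence (θ_{n+1} ≤ A·θ_n for a fixed 0 < A < 1) and let α ∈ [0, π/2] and c > 0 be such that |tan(α − θ) − p/q| > c/(q² (log q)²) for all θ ∈ Ω ∪ {0} ∪ (Ω + π/2) ∪ {π/2}, all integers p and positive integers q. For N ≥ 2 let V be the square [0, N^{1/2})² rotated counterclockwise by α, and let A_{Ω,α} be the family of rectangles R ⊆ V one of whose sides is either parallel to a side of V or makes angle θ − α with the x-axis for some θ ∈ Ω. Then there is a constant C (independent of N and R) such that for every R ∈ A_{Ω,α}, |#(ℤ² ∩ R) − area(R)| ≤ C (log N)³. -/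

import Mathlib

open MeasureTheory

noncomputable section

/-- Rotation of the plane by angle `φ`. -/
def rot (φ : ℝ) (x : ℝ × ℝ) : ℝ × ℝ :=
  (x.1 * Real.cos φ - x.2 * Real.sin φ, x.1 * Real.sin φ + x.2 * Real.cos φ)

/-- The rectangle obtained by rotating `[0,w] × [0,h]` by angle `φ` and translating by `p`. -/
def rect (φ : ℝ) (p : ℝ × ℝ) (w h : ℝ) : Set (ℝ × ℝ) :=
  (fun x => p + rot φ x) '' (Set.Icc 0 w ×ˢ Set.Icc 0 h)

/-- The square `[0, N^{1/2})²` rotated counterclockwise by `α`. -/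
def Vsq (α : ℝ) (N : ℕ) : Set (ℝ × ℝ) :=
  rot α '' (Set.Ico 0 (Real.sqrt N) ×ˢ Set.Ico 0 (Real.sqrt N))

/-- The integer lattice `ℤ²` viewed as a subset of `ℝ²`. -/
def lattice : Set (ℝ × ℝ) := {x | ∃ m n : ℤ, x = ((m : ℝ), (n : ℝ))}

/-- `plog q = max {1, log₂ q}`. -/
def plog (q : ℕ) : ℝ := max 1 (Real.logb 2 q)

/-- The diophantine condition `|t - p/q| > c / (q² (log q)²)` for all fractions `p/q`. -/
def IsDiophantine (c t : ℝ) : Prop :=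
  ∀ (p : ℤ) (q : ℕ), 0 < q → c / ((q : ℝ) ^ 2 * plog q ^ 2) < |t - (p : ℝ) / (q : ℝ)|

theorem one_le_plog (q : ℕ) : 1 ≤ plog q := le_max_left _ _

theorem IsDiophantine.neg {c t : ℝ} (h : IsDiophantine c t) : IsDiophantine c (-t) := by
  intro p q hq
  have := h (-p) q hq
  rw [← abs_neg] at this
  convert this using 2
  push_cast
  ring

theorem IsDiophantine.lt_abs {c t : ℝ} (h : IsDiophantine c t) : c < |t| := by
  simpa [plog] using h 0 1 one_pos

theorem IsDiophantine.irrational {c t : ℝ} (hc : 0 < c) (h : IsDiophantine c t) :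
    Irrational t := by
  rintro ⟨r, rfl⟩
  have h1 := h r.num r.den r.pos
  have h2 : ((r.num : ℝ) / (r.den : ℝ)) = (r : ℝ) := by exact_mod_cast r.num_div_den
  rw [h2, sub_self, abs_zero] at h1
  have : 0 ≤ c / ((r.den : ℝ) ^ 2 * plog r.den ^ 2) := by positivity
  linarith

/-- Multiplication by a numerator coprime to `q`, followed by a shift, permutes the residues
modulo `q`. -/
theorem sum_range_emod (r : ℚ) (j : ℤ) (g : ℕ → ℝ) :
    ∑ i ∈ Finset.range r.den, g ((j + r.num * i) % r.den).toNat
      = ∑ k ∈ Finset.range r.den, g k := by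
  have hq : (0 : ℤ) < r.den := by exact_mod_cast r.pos
  have hinj : Set.InjOn (fun i : ℕ => ((j + r.num * i) % r.den).toNat)
      (Finset.range r.den : Set ℕ) := by
    intro a ha b hb hab
    simp only [Finset.coe_range, Set.mem_Iio] at ha hb
    have h1 := Int.emod_nonneg (j + r.num * a) hq.ne'
    have h2 := Int.emod_nonneg (j + r.num * b) hq.ne'
    have h3 : (j + r.num * a) % r.den = (j + r.num * b) % r.den := by
      simp only at hab
      omega
    have h4 : (r.den : ℤ) ∣ r.num * (b - a) := by
      have := Int.ModEq.dvd h3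
      convert this using 1
      ring
    have h5 : IsCoprime (r.den : ℤ) r.num := by
      rw [Int.isCoprime_iff_gcd_eq_one, Int.gcd_comm]
      exact r.reduced
    have h6 := h5.dvd_of_dvd_mul_left h4
    have h7 : ((b : ℤ) - a) = 0 := by
      apply Int.eq_zero_of_abs_lt_dvd h6
      rw [abs_lt]
      omega
    omega
  have himg : (Finset.range r.den).image (fun i : ℕ => ((j + r.num * i) % r.den).toNat)
      = Finset.range r.den := by
    apply Finset.eq_of_subset_of_card_le
    · intro k hk
      simp only [Finset.mem_image, Finset.mem_range] at hk ⊢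
      obtain ⟨i, -, rfl⟩ := hk
      have h1 := Int.emod_nonneg (j + r.num * i) hq.ne'
      have h2 := Int.emod_lt_of_pos (j + r.num * i) hq
      omega
    · rw [Finset.card_image_of_injOn hinj]
  conv_rhs => rw [← himg, Finset.sum_image hinj]

/-- The sum of the sawtooth function over a full period of a good rational approximation. -/
theorem abs_sum_fract_den_le (t s : ℝ) (r : ℚ) (hr : |t - r| * (r.den : ℝ) ^ 2 ≤ 1) :
    |∑ i ∈ Finset.range r.den, (Int.fract (s + t * i) - 1 / 2)| ≤ 6 := by
  set q := r.den with hqdef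
  have hqpos : 0 < q := r.pos
  have hq0 : (0 : ℝ) < q := by exact_mod_cast hqpos
  set σ := Int.fract (s * q) with hσ
  have hσ0 : 0 ≤ σ := Int.fract_nonneg _
  have hσ1 : σ < 1 := Int.fract_lt_one _
  set j := ⌊s * q⌋ with hj
  have hsq : s * q = j + σ := (Int.floor_add_fract _).symm
  have hrq : (r : ℝ) * q = r.num := by exact_mod_cast r.mul_den_eq_num
  let e : ℕ → ℝ := fun k => 1 / q + (if k = 0 then 2 else 0) + (if k = q - 1 then 2 else 0)
  have key : ∀ i ∈ Finset.range q,
      |(Int.fract (s + t * i) - 1 / 2) -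
        (((((j + r.num * i) % q).toNat : ℕ) + σ) / q - 1 / 2)|
        ≤ e ((j + r.num * i) % q).toNat := by
    intro i hi
    have hiq : (i : ℝ) < q := by exact_mod_cast Finset.mem_range.mp hi
    have hi0 : (0 : ℝ) ≤ i := by positivity
    set k := ((j + r.num * i) % q).toNat with hk
    have hqz : (0 : ℤ) < q := by exact_mod_cast hqpos
    have h1 := Int.emod_nonneg (j + r.num * i) hqz.ne'
    have h2 := Int.emod_lt_of_pos (j + r.num * i) hqz
    have hkq : k < q := by omega
    have hkz : (k : ℤ) = (j + r.num * i) % q := by omega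
    have hdiv : (q : ℤ) * ((j + r.num * i) / q) + k = j + r.num * i := by
      rw [hkz]; exact Int.mul_ediv_add_emod _ _
    set z := (j + r.num * i) / (q : ℤ) with hz
    have hdivR : (q : ℝ) * z + k = j + r.num * i := by exact_mod_cast hdiv
    set δ := (t - r) * i with hδ
    have hδq : |δ| * q ≤ 1 := by
      rw [hδ, abs_mul, abs_of_nonneg hi0]
      nlinarith [abs_nonneg (t - r), mul_nonneg (abs_nonneg (t - r)) hq0.le]
    have hst : s + t * i = ((k + σ) / q + δ) + z := by
      field_simp
      rw [hδ]
      linear_combination hsq - hdivR + i * hrq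
    rw [hst, Int.fract_add_intCast]
    have hk0 : (0 : ℝ) ≤ k := by positivity
    have hkq' : (k : ℝ) + 1 ≤ q := by exact_mod_cast hkq
    have hx0 : 0 ≤ (k + σ) / q := by positivity
    have hx1 : (k + σ) / q < 1 := by rw [div_lt_one hq0]; linarith
    have hf0 := Int.fract_nonneg ((k + σ) / q + δ)
    have hf1 := Int.fract_lt_one ((k + σ) / q + δ)
    have hinv : 0 < 1 / (q : ℝ) := by positivity
    have crude : |(Int.fract ((k + σ) / q + δ) - 1 / 2) - ((k + σ) / q - 1 / 2)| ≤ 2 := by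
      rw [abs_le]; constructor <;> linarith
    by_cases hka : k = 0
    · refine crude.trans ?_
      simp only [e, if_pos hka]
      split_ifs <;> linarith
    by_cases hkb : k = q - 1
    · refine crude.trans ?_
      simp only [e, if_pos hkb]
      split_ifs <;> linarith
    have hδle : |δ| ≤ 1 / q := by rw [le_div_iff₀ hq0]; exact hδq
    have hδ' := abs_le.mp hδle
    have hk1 : (1 : ℝ) ≤ k := by exact_mod_cast Nat.one_le_iff_ne_zero.mpr hka
    have hk2 : (k : ℝ) + 2 ≤ q := by
      have : k + 2 ≤ q := by omega
      exact_mod_cast this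
    have hlow : 1 / (q : ℝ) ≤ (k + σ) / q := by gcongr; linarith
    have hup : (k + σ) / q + 1 / q < 1 := by
      rw [← add_div, div_lt_one hq0]; linarith
    rw [Int.fract_eq_self.mpr ⟨by linarith, by linarith⟩]
    simp only [e, if_neg hka, if_neg hkb]
    convert hδle using 1
    · congr 1; ring
    · ring
  have hmain : ∑ k ∈ Finset.range q, (((k : ℕ) + σ) / q - 1 / 2) = σ - 1 / 2 := by
    have hg : (∑ k ∈ Finset.range q, (k : ℝ)) = q * (q - 1) / 2 := by
      clear_value q
      clear * -
      induction q with
      | zero => simp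
      | succ n ih => rw [Finset.sum_range_succ, ih]; push_cast; ring
    rw [Finset.sum_sub_distrib, ← Finset.sum_div, Finset.sum_add_distrib, hg]
    simp only [Finset.sum_const, Finset.card_range, nsmul_eq_mul]
    field_simp
    ring
  have he : ∑ k ∈ Finset.range q, e k = 5 := by
    simp only [e, Finset.sum_add_distrib, Finset.sum_ite_eq', Finset.mem_range, Finset.sum_const,
      Finset.card_range, nsmul_eq_mul]
    rw [if_pos hqpos, if_pos (by omega)]
    field_simp
    norm_num
  have hre1 := sum_range_emod r j (fun k => ((k : ℝ) + σ) / q - 1 / 2)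
  have hre2 := sum_range_emod r j e
  rw [← hqdef] at hre1 hre2
  have hb := (Finset.abs_sum_le_sum_abs _ _).trans (Finset.sum_le_sum key)
  rw [hre2, he, Finset.sum_sub_distrib, hre1, hmain] at hb
  rw [abs_le] at hb ⊢
  constructor <;> linarith [hb.1, hb.2]

theorem abs_sum_fract_den_mul_le (t : ℝ) (r : ℚ) (hr : |t - r| * (r.den : ℝ) ^ 2 ≤ 1) (k : ℕ) :
    ∀ s : ℝ, |∑ i ∈ Finset.range (r.den * k), (Int.fract (s + t * i) - 1 / 2)| ≤ 6 * k := by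
  induction k with
  | zero => simp
  | succ k ih =>
    intro s
    rw [mul_add, mul_one, Finset.sum_range_add]
    have h := abs_sum_fract_den_le t (s + t * (r.den * k)) r hr
    have h2 : ∀ i : ℕ, s + t * ((r.den * k + i : ℕ) : ℝ) = s + t * (r.den * k) + t * i := by
      intro i; push_cast; ring
    simp only [h2]
    refine (abs_add_le _ _).trans ?_
    push_cast
    linarith [ih s]

theorem plog_le_of_lt_two_pow {q J : ℕ} (hq : 0 < q) (hJ : 1 ≤ J) (h : q < 2 ^ J) :
    plog q ≤ J := by
  refine max_le (by exact_mod_cast hJ) ?_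
  rw [Real.logb_le_iff_le_rpow (by norm_num) (by exact_mod_cast hq), Real.rpow_natCast]
  exact_mod_cast h.le

theorem abs_sum_fract_le_mul {c t : ℝ} (hc : 0 < c) (ht : IsDiophantine c t) {J : ℕ} (hJ : 1 ≤ J)
    (j : ℕ) : ∀ n < 2 ^ j, n < 2 ^ J → ∀ s : ℝ,
      |∑ i ∈ Finset.range n, (Int.fract (s + t * i) - 1 / 2)| ≤ 6 * J ^ 2 / c * j := by
  induction j with
  | zero =>
    intro n hn _ s
    obtain rfl : n = 0 := by simpa using hn
    simp
  | succ j ih =>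
    intro n hn hnJ s
    rcases Nat.eq_zero_or_pos n with rfl | hn0
    · simp; positivity
    obtain ⟨r, hr, hrn⟩ := Real.exists_rat_abs_sub_le_and_den_le t hn0
    have hq : 0 < r.den := r.pos
    have hqR : (0 : ℝ) < r.den := by exact_mod_cast hq
    have hrnR : (r.den : ℝ) ≤ n := by exact_mod_cast hrn
    have hr' : |t - r| * (r.den : ℝ) ^ 2 ≤ 1 := by
      rw [le_div_iff₀ (by positivity)] at hr
      nlinarith [mul_nonneg (abs_nonneg (t - r)) hqR.le]
    have hdq := ht r.num r.den hq
    have hnd : ((r.num : ℝ) / (r.den : ℝ)) = (r : ℝ) := by exact_mod_cast r.num_div_den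
    rw [hnd] at hdq
    have hpl := plog_le_of_lt_two_pow hq hJ (hrn.trans_lt hnJ)
    have hpl1 := one_le_plog r.den
    have hquot : ((n / r.den : ℕ) : ℝ) ≤ J ^ 2 / c := by
      have h1 : ((n / r.den : ℕ) : ℝ) ≤ (n : ℝ) / r.den := Nat.cast_div_le
      have h2 := hdq.trans_le hr
      rw [div_lt_div_iff₀ (by positivity) (by positivity)] at h2
      have h3 : c * (n + 1) < r.den * plog r.den ^ 2 := by
        have : (c * (n + 1)) * r.den < (r.den * plog r.den ^ 2) * r.den := by linarith
        exact lt_of_mul_lt_mul_right this hqR.le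
      have h4 : plog r.den ^ 2 ≤ (J : ℝ) ^ 2 := by gcongr
      refine h1.trans ?_
      rw [div_le_div_iff₀ hqR hc]
      nlinarith [mul_le_mul_of_nonneg_left h4 hqR.le]
    have hmod : n % r.den < 2 ^ j := by
      have h1 := Nat.mod_add_div n r.den
      have h2 := Nat.mod_lt n hq
      have h3 : 1 ≤ n / r.den := Nat.div_pos hrn hq
      have h4 : r.den ≤ r.den * (n / r.den) := Nat.le_mul_of_pos_right _ h3
      rw [pow_succ] at hn
      omega
    have hA := abs_sum_fract_den_mul_le t r hr' (n / r.den) s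
    have hB := ih (n % r.den) hmod ((Nat.mod_le _ _).trans_lt hnJ)
      (s + t * (r.den * (n / r.den : ℕ)))
    conv_lhs => rw [← Nat.div_add_mod n r.den]
    rw [Finset.sum_range_add]
    have h2 : ∀ i : ℕ, s + t * ((r.den * (n / r.den) + i : ℕ) : ℝ)
        = s + t * (r.den * (n / r.den : ℕ)) + t * i := by
      intro i; push_cast; ring
    simp only [h2]
    refine (abs_add_le _ _).trans ?_
    have h5 : 6 * (J : ℝ) ^ 2 / c * ((j + 1 : ℕ) : ℝ) = 6 * (J ^ 2 / c) + 6 * J ^ 2 / c * j := by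
      push_cast; ring
    rw [h5]
    linarith

/-- Sums of the sawtooth function along a diophantine progression are `O((log n)³)`. -/
theorem abs_sum_fract_le {c t : ℝ} (hc : 0 < c) (ht : IsDiophantine c t) {J n : ℕ} (hJ : 1 ≤ J)
    (hn : n < 2 ^ J) (s : ℝ) :
    |∑ i ∈ Finset.range n, (Int.fract (s + t * i) - 1 / 2)| ≤ 6 * J ^ 3 / c := by
  have := abs_sum_fract_le_mul hc ht hJ J n hn hn s
  convert this using 1
  ring

theorem exists_split_of_antitone (P : ℕ → Prop) (hP : ∀ i, P (i + 1) → P i) (n : ℕ) :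
    ∃ k l, k + l = n ∧ (∀ i < k, P i) ∧ ∀ i < l, ¬ P (k + i) := by
  induction n with
  | zero => exact ⟨0, 0, rfl, by simp, by simp⟩
  | succ n ih =>
    obtain ⟨k, l, hkl, h1, h2⟩ := ih
    by_cases hn : P n
    · have hall : ∀ d ≤ n, P (n - d) := by
        intro d
        induction d with
        | zero => intro _; simpa using hn
        | succ d ih =>
          intro hd
          apply hP
          have := ih (by omega)
          rwa [show n - (d + 1) + 1 = n - d by omega]
      refine ⟨n + 1, 0, rfl, fun i hi => ?_, by simp⟩
      have := hall (n - i) (by omega)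
      rwa [show n - (n - i) = i by omega] at this
    · refine ⟨k, l + 1, by omega, h1, fun i hi => ?_⟩
      rcases Nat.lt_succ_iff_lt_or_eq.mp hi with h | rfl
      · exact h2 i h
      · rwa [hkl]

/-- The sum of the integer parts of the minimum of two affine functions with diophantine slopes. -/
theorem abs_sum_min_floor_sub_le {c t u : ℝ} (hc : 0 < c) (ht : IsDiophantine c t)
    (hu : IsDiophantine c u) (htu : u < t) {J n : ℕ} (hJ : 1 ≤ J) (hn : n < 2 ^ J) (b b' : ℝ) :
    |∑ i ∈ Finset.range n,
      (((min ⌊b + t * i⌋ ⌊b' + u * i⌋ : ℤ) : ℝ) - min (b + t * i) (b' + u * i) + 1 / 2)|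
      ≤ 12 * J ^ 3 / c := by
  obtain ⟨k, l, hkl, h1, h2⟩ := exists_split_of_antitone
    (fun i : ℕ => b + t * i ≤ b' + u * i) (by
      intro i hi
      push_cast at hi
      nlinarith) n
  have hk : k < 2 ^ J := by omega
  have hl : l < 2 ^ J := by omega
  have e1 : ∑ i ∈ Finset.range k,
      (((min ⌊b + t * i⌋ ⌊b' + u * i⌋ : ℤ) : ℝ) - min (b + t * i) (b' + u * i) + 1 / 2)
      = -∑ i ∈ Finset.range k, (Int.fract (b + t * i) - 1 / 2) := by
    rw [← Finset.sum_neg_distrib]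
    refine Finset.sum_congr rfl fun i hi => ?_
    have h := h1 i (Finset.mem_range.mp hi)
    rw [min_eq_left (Int.floor_le_floor h), min_eq_left h, Int.fract]
    ring
  have e2 : ∑ i ∈ Finset.range l,
      (((min ⌊b + t * (k + i : ℕ)⌋ ⌊b' + u * (k + i : ℕ)⌋ : ℤ) : ℝ)
        - min (b + t * (k + i : ℕ)) (b' + u * (k + i : ℕ)) + 1 / 2)
      = -∑ i ∈ Finset.range l, (Int.fract ((b' + u * k) + u * i) - 1 / 2) := by
    rw [← Finset.sum_neg_distrib]
    refine Finset.sum_congr rfl fun i hi => ?_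
    have h := (not_le.mp (h2 i (Finset.mem_range.mp hi))).le
    rw [min_eq_right (Int.floor_le_floor h), min_eq_right h,
      show b' + u * k + u * i = b' + u * (k + i : ℕ) by push_cast; ring, Int.fract]
    ring
  rw [← hkl, Finset.sum_range_add, e1, e2]
  refine (abs_add_le _ _).trans ?_
  rw [abs_neg, abs_neg]
  have := abs_sum_fract_le hc ht hJ hk b
  have := abs_sum_fract_le hc hu hJ hl (b' + u * k)
  have e : 12 * (J : ℝ) ^ 3 / c = 6 * J ^ 3 / c + 6 * J ^ 3 / c := by ring
  linarith

/-- Comparison of a sum of a ramp function with its closed form. -/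
theorem sum_ramp (x : ℝ) (hx : -1 ≤ x) (n : ℕ) :
    ((n : ℝ) - 1 ≤ x → ∑ i ∈ Finset.range n, max 0 ((i : ℝ) - x) = 0) ∧
    (x ≤ n → |∑ i ∈ Finset.range n, max 0 ((i : ℝ) - x) - (n - x) * (n - 1 - x) / 2| ≤ 1 / 8) := by
  have near : ∀ v : ℝ, 0 ≤ v → v ≤ 1 → |0 - v * (v - 1) / 2| ≤ 1 / 8 := by
    intro v h0 h1
    rw [abs_le]
    constructor <;> nlinarith [sq_nonneg (v - 1 / 2), mul_nonneg h0 (sub_nonneg.mpr h1)]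
  induction n with
  | zero =>
    refine ⟨by simp, fun h => ?_⟩
    have := near (-x) (by simpa using h) (by linarith)
    simp only [Finset.range_zero, Finset.sum_empty, Nat.cast_zero]
    convert this using 2
    ring
  | succ n ih =>
    rw [Finset.sum_range_succ]
    push_cast
    have hzero : (n : ℝ) ≤ x →
        ∑ i ∈ Finset.range n, max 0 ((i : ℝ) - x) + max 0 ((n : ℝ) - x) = 0 := by
      intro h
      rw [ih.1 (by linarith), max_eq_left (by linarith), add_zero]
    refine ⟨fun h => hzero (by linarith), fun h => ?_⟩
    rcases le_total (n : ℝ) x with hnx | hnx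
    · rw [hzero hnx]
      convert near (n + 1 - x) (by linarith) (by linarith) using 2
      ring
    · rw [max_eq_right (by linarith)]
      convert ih.2 hnx using 2
      ring

/-- The total length of the integer columns of a parallelogram. -/
theorem abs_sum_min_sub_area_le {t u a b a' b' : ℝ} (htu : u < t) (hab : a ≤ b) (hab' : a' ≤ b')
    {n : ℕ} (h0 : -(t - u) ≤ a' - b) (hn : b' - a ≤ n * (t - u)) :
    |∑ i ∈ Finset.range n, (min (b + t * i) (b' + u * i) - min (a + t * i) (b' + u * i)
        - min (b + t * i) (a' + u * i) + min (a + t * i) (a' + u * i))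
      - (b - a) * (b' - a') / (t - u)| ≤ (t - u) / 2 := by
  set D := t - u with hD
  have hDpos : 0 < D := by linarith
  have hmin : ∀ (y z : ℝ) (i : ℕ),
      min (y + t * i) (z + u * i) = y + t * i - D * max 0 ((i : ℝ) - (z - y) / D) := by
    intro y z i
    rw [mul_max_of_nonneg _ _ hDpos.le, mul_zero, mul_sub, mul_div_cancel₀ _ hDpos.ne', hD]
    rcases le_total (y + t * i) (z + u * i) with h | h
    · rw [min_eq_left h, max_eq_left (by linarith)]; ring
    · rw [min_eq_right h, max_eq_right (by linarith)]; ring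
  have hramp : ∀ y z : ℝ, a ≤ y → y ≤ b → a' ≤ z → z ≤ b' →
      |∑ i ∈ Finset.range n, max 0 ((i : ℝ) - (z - y) / D)
        - (n - (z - y) / D) * (n - 1 - (z - y) / D) / 2| ≤ 1 / 8 := by
    intro y z h1 h2 h3 h4
    refine (sum_ramp _ ?_ n).2 ?_
    · rw [le_div_iff₀ hDpos]; linarith
    · rw [div_le_iff₀ hDpos]; linarith
  have r1 := hramp b b' hab le_rfl hab' le_rfl
  have r2 := hramp a b' le_rfl hab hab' le_rfl
  have r3 := hramp b a' hab le_rfl le_rfl hab'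
  have r4 := hramp a a' le_rfl hab le_rfl hab'
  have hsum : ∑ i ∈ Finset.range n, (min (b + t * i) (b' + u * i) - min (a + t * i) (b' + u * i)
        - min (b + t * i) (a' + u * i) + min (a + t * i) (a' + u * i))
      = -D * (∑ i ∈ Finset.range n, max 0 ((i : ℝ) - (b' - b) / D)
        - ∑ i ∈ Finset.range n, max 0 ((i : ℝ) - (b' - a) / D)
        - ∑ i ∈ Finset.range n, max 0 ((i : ℝ) - (a' - b) / D)
        + ∑ i ∈ Finset.range n, max 0 ((i : ℝ) - (a' - a) / D)) := by
    rw [← Finset.sum_sub_distrib, ← Finset.sum_sub_distrib, ← Finset.sum_add_distrib,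
      Finset.mul_sum]
    refine Finset.sum_congr rfl fun i _ => ?_
    simp only [hmin]
    ring
  have harea : (b - a) * (b' - a') / D
      = -D * ((n - (b' - b) / D) * (n - 1 - (b' - b) / D) / 2
        - (n - (b' - a) / D) * (n - 1 - (b' - a) / D) / 2
        - (n - (a' - b) / D) * (n - 1 - (a' - b) / D) / 2
        + (n - (a' - a) / D) * (n - 1 - (a' - a) / D) / 2) := by
    field_simp
    ring
  rw [hsum, harea, ← mul_sub, abs_mul, abs_neg, abs_of_pos hDpos]
  have : |∑ i ∈ Finset.range n, max 0 ((i : ℝ) - (b' - b) / D)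
        - ∑ i ∈ Finset.range n, max 0 ((i : ℝ) - (b' - a) / D)
        - ∑ i ∈ Finset.range n, max 0 ((i : ℝ) - (a' - b) / D)
        + ∑ i ∈ Finset.range n, max 0 ((i : ℝ) - (a' - a) / D)
      - ((n - (b' - b) / D) * (n - 1 - (b' - b) / D) / 2
        - (n - (b' - a) / D) * (n - 1 - (b' - a) / D) / 2
        - (n - (a' - b) / D) * (n - 1 - (a' - b) / D) / 2
        + (n - (a' - a) / D) * (n - 1 - (a' - a) / D) / 2)| ≤ 1 / 2 := by
    rw [abs_le] at r1 r2 r3 r4 ⊢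
    constructor <;> linarith [r1.1, r1.2, r2.1, r2.2, r3.1, r3.2, r4.1, r4.2]
  calc _ ≤ D * (1 / 2) := by gcongr
    _ = D / 2 := by ring

/-- Number of lattice points in a half-open parallelogram, column by column. -/
theorem ncard_halfOpen_eq_sum {t u a b a' b' : ℝ} (htu : u < t) (hab : a ≤ b) (hab' : a' ≤ b')
    {n : ℕ} {m₀ : ℤ} (h0 : (m₀ : ℝ) * (t - u) ≤ a' - b) (hn : b' - a ≤ (m₀ + n) * (t - u)) :
    {z : ℤ × ℤ | (a < z.2 - t * z.1 ∧ z.2 - t * z.1 ≤ b) ∧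
        (a' < z.2 - u * z.1 ∧ z.2 - u * z.1 ≤ b')}.Finite ∧
    ({z : ℤ × ℤ | (a < z.2 - t * z.1 ∧ z.2 - t * z.1 ≤ b) ∧
        (a' < z.2 - u * z.1 ∧ z.2 - u * z.1 ≤ b')}.ncard : ℤ)
      = ∑ i ∈ Finset.range n,
        (min ⌊(b + t * m₀) + t * i⌋ ⌊(b' + u * m₀) + u * i⌋
          - min ⌊(a + t * m₀) + t * i⌋ ⌊(b' + u * m₀) + u * i⌋
          - min ⌊(b + t * m₀) + t * i⌋ ⌊(a' + u * m₀) + u * i⌋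
          + min ⌊(a + t * m₀) + t * i⌋ ⌊(a' + u * m₀) + u * i⌋) := by
  classical
  let col : ℕ → Finset ℤ := fun i =>
    Finset.Ioc (max ⌊(a + t * m₀) + t * i⌋ ⌊(a' + u * m₀) + u * i⌋)
      (min ⌊(b + t * m₀) + t * i⌋ ⌊(b' + u * m₀) + u * i⌋)
  have hmem : ∀ (i : ℕ) (y : ℤ), y ∈ col i ↔
      (a < y - t * (m₀ + i : ℤ) ∧ y - t * (m₀ + i : ℤ) ≤ b) ∧
        (a' < y - u * (m₀ + i : ℤ) ∧ y - u * (m₀ + i : ℤ) ≤ b') := by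
    intro i y
    simp only [col, Finset.mem_Ioc, max_lt_iff, le_min_iff, Int.floor_lt, Int.le_floor]
    push_cast
    constructor
    · rintro ⟨⟨h1, h2⟩, h3, h4⟩
      refine ⟨⟨?_, ?_⟩, ?_, ?_⟩ <;> linarith
    · rintro ⟨⟨h1, h2⟩, h3, h4⟩
      refine ⟨⟨?_, ?_⟩, ?_, ?_⟩ <;> linarith
  let f : (Σ _ : ℕ, ℤ) → ℤ × ℤ := fun x => (m₀ + x.1, x.2)
  have hf : Function.Injective f := by
    rintro ⟨i, y⟩ ⟨i', y'⟩ h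
    simp only [f, Prod.mk.injEq, add_right_inj, Nat.cast_inj] at h
    obtain ⟨rfl, rfl⟩ := h
    rfl
  have hset : {z : ℤ × ℤ | (a < z.2 - t * z.1 ∧ z.2 - t * z.1 ≤ b) ∧
        (a' < z.2 - u * z.1 ∧ z.2 - u * z.1 ≤ b')}
      = (((Finset.range n).sigma col).image f : Finset (ℤ × ℤ)) := by
    ext ⟨x, y⟩
    simp only [Set.mem_ofPred_eq, Finset.coe_image, Set.mem_image, Finset.mem_coe, Finset.mem_sigma,
      Finset.mem_range, f, Sigma.exists, Prod.mk.injEq]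
    constructor
    · intro h
      have hD : 0 < t - u := by linarith
      have h1 : (m₀ : ℝ) < x := by
        refine lt_of_mul_lt_mul_right (a := t - u) ?_ hD.le
        linarith [h.1.1, h.1.2, h.2.1, h.2.2]
      have h2 : (x : ℝ) < m₀ + n := by
        refine lt_of_mul_lt_mul_right (a := t - u) ?_ hD.le
        linarith [h.1.1, h.1.2, h.2.1, h.2.2]
      have h1' : m₀ < x := by exact_mod_cast h1
      have h2' : x < m₀ + n := by exact_mod_cast h2
      have hx : m₀ + ((x - m₀).toNat : ℤ) = x := by omega
      refine ⟨(x - m₀).toNat, y, ⟨by omega, ?_⟩, hx, rfl⟩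
      rw [hmem, hx]
      exact h
    · rintro ⟨i, y', ⟨-, hy⟩, rfl, rfl⟩
      exact (hmem i y').mp hy
  rw [hset]
  refine ⟨Finset.finite_toSet _, ?_⟩
  rw [Set.ncard_coe_finset, Finset.card_image_of_injective _ hf, Finset.card_sigma]
  push_cast
  refine Finset.sum_congr rfl fun i _ => ?_
  simp only [col, Int.card_Ioc]
  have h1 : ⌊(a + t * m₀) + t * i⌋ ≤ ⌊(b + t * m₀) + t * i⌋ := Int.floor_le_floor (by linarith)
  have h2 : ⌊(a' + u * m₀) + u * i⌋ ≤ ⌊(b' + u * m₀) + u * i⌋ := Int.floor_le_floor (by linarith)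
  omega

theorem subsingleton_lattice_line {t : ℝ} (ht : Irrational t) (a : ℝ) :
    {z : ℤ × ℤ | (z.2 : ℝ) - t * z.1 = a}.Subsingleton := by
  rintro ⟨x, y⟩ h ⟨x', y'⟩ h'
  simp only [Set.mem_ofPred_eq] at h h'
  have hxx : x = x' := by
    by_contra hne
    have hne' : ((x - x' : ℤ) : ℝ) ≠ 0 := by exact_mod_cast sub_ne_zero.mpr hne
    apply ht
    refine ⟨((y - y' : ℤ) : ℚ) / ((x - x' : ℤ) : ℚ), ?_⟩
    push_cast at hne' ⊢
    rw [div_eq_iff hne']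
    linarith
  subst hxx
  have : (y : ℝ) = y' := by linarith
  simpa using this

/-- Discrepancy of a closed parallelogram whose sides have diophantine slopes. -/
theorem abs_ncard_parallelogram_sub_area_le {c t u a b a' b' : ℝ} (hc : 0 < c)
    (ht : IsDiophantine c t) (hu : IsDiophantine c u) (htu : u < t) (hab : a ≤ b) (hab' : a' ≤ b')
    {J : ℕ} (hJ : 1 ≤ J) (hwidth : ((b - a) + (b' - a')) / (t - u) + 2 < 2 ^ J) :
    |({z : ℤ × ℤ | (a ≤ z.2 - t * z.1 ∧ z.2 - t * z.1 ≤ b) ∧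
        (a' ≤ z.2 - u * z.1 ∧ z.2 - u * z.1 ≤ b')}.ncard : ℝ) - (b - a) * (b' - a') / (t - u)|
      ≤ 48 * J ^ 3 / c + (t - u) / 2 + 2 := by
  set D := t - u with hD
  have hDpos : 0 < D := by linarith
  set m₀ : ℤ := ⌊(a' - b) / D⌋ with hm
  set n : ℕ := ⌈(b' - a) / D - m₀⌉₊ with hnd
  have hm1 : (m₀ : ℝ) * D ≤ a' - b := by
    rw [← le_div_iff₀ hDpos]; exact Int.floor_le _
  have hm2 : a' - b ≤ (m₀ + 1) * D := by
    rw [← div_le_iff₀ hDpos]; exact (Int.lt_floor_add_one _).le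
  have hn1 : b' - a ≤ (m₀ + n) * D := by
    rw [← div_le_iff₀ hDpos]; linarith [Nat.le_ceil ((b' - a) / D - m₀)]
  have hn2 : n < 2 ^ J := by
    have hpos : 0 ≤ (b' - a) / D - m₀ := by
      rw [sub_nonneg, le_div_iff₀ hDpos]; linarith
    have h1 := Nat.ceil_lt_add_one hpos
    have h2 := Int.lt_floor_add_one ((a' - b) / D)
    have h3 : ((b - a) + (b' - a')) / D = (b' - a) / D - (a' - b) / D := by ring
    have : (n : ℝ) < 2 ^ J := by linarith
    exact_mod_cast this
  obtain ⟨hfin, hcount⟩ := ncard_halfOpen_eq_sum htu hab hab' hm1 hn1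
  set H := {z : ℤ × ℤ | (a < z.2 - t * z.1 ∧ z.2 - t * z.1 ≤ b) ∧
        (a' < z.2 - u * z.1 ∧ z.2 - u * z.1 ≤ b')} with hH
  set T := {z : ℤ × ℤ | (a ≤ z.2 - t * z.1 ∧ z.2 - t * z.1 ≤ b) ∧
        (a' ≤ z.2 - u * z.1 ∧ z.2 - u * z.1 ≤ b')} with hT
  have hl1 := subsingleton_lattice_line (ht.irrational hc) a
  have hl2 := subsingleton_lattice_line (hu.irrational hc) a'
  have hTsub : T ⊆ H ∪ ({z : ℤ × ℤ | (z.2 : ℝ) - t * z.1 = a} ∪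
      {z : ℤ × ℤ | (z.2 : ℝ) - u * z.1 = a'}) := by
    intro z hz
    rcases hz.1.1.eq_or_lt with h1 | h1
    · exact Or.inr (Or.inl h1.symm)
    rcases hz.2.1.eq_or_lt with h2 | h2
    · exact Or.inr (Or.inr h2.symm)
    exact Or.inl ⟨⟨h1, hz.1.2⟩, h2, hz.2.2⟩
  have hfinU := hfin.union (hl1.finite.union hl2.finite)
  have hHT : H ⊆ T := fun z hz => ⟨⟨hz.1.1.le, hz.1.2⟩, hz.2.1.le, hz.2.2⟩
  have hc1 : H.ncard ≤ T.ncard := Set.ncard_le_ncard hHT (hfinU.subset hTsub)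
  have hc2 : T.ncard ≤ H.ncard + 2 := by
    have h1 := Set.ncard_le_ncard hTsub hfinU
    have h2 := Set.ncard_union_le H ({z : ℤ × ℤ | (z.2 : ℝ) - t * z.1 = a} ∪
      {z : ℤ × ℤ | (z.2 : ℝ) - u * z.1 = a'})
    have h3 := Set.ncard_union_le {z : ℤ × ℤ | (z.2 : ℝ) - t * z.1 = a}
      {z : ℤ × ℤ | (z.2 : ℝ) - u * z.1 = a'}
    have h5 := (Set.ncard_le_one hl1.finite).mpr fun _ hx _ hy => hl1 hx hy
    have h6 := (Set.ncard_le_one hl2.finite).mpr fun _ hx _ hy => hl2 hx hy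
    omega
  have hc1' : (H.ncard : ℝ) ≤ T.ncard := by exact_mod_cast hc1
  have hc2' : (T.ncard : ℝ) ≤ H.ncard + 2 := by exact_mod_cast hc2
  have hcountR := congrArg (Int.cast : ℤ → ℝ) hcount
  have harea := abs_sum_min_sub_area_le (n := n) htu (a := a + t * m₀) (b := b + t * m₀)
    (a' := a' + u * m₀) (b' := b' + u * m₀) (by linarith) (by linarith)
    (by rw [hD] at hm1 hm2; linarith) (by rw [hD] at hn1; linarith)
  have f1 := abs_sum_min_floor_sub_le hc ht hu htu hJ hn2 (b + t * m₀) (b' + u * m₀)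
  have f2 := abs_sum_min_floor_sub_le hc ht hu htu hJ hn2 (a + t * m₀) (b' + u * m₀)
  have f3 := abs_sum_min_floor_sub_le hc ht hu htu hJ hn2 (b + t * m₀) (a' + u * m₀)
  have f4 := abs_sum_min_floor_sub_le hc ht hu htu hJ hn2 (a + t * m₀) (a' + u * m₀)
  rw [show b + t * m₀ - (a + t * m₀) = b - a by ring,
    show b' + u * m₀ - (a' + u * m₀) = b' - a' by ring] at harea
  push_cast at hcountR f1 f2 f3 f4
  simp only [Finset.sum_add_distrib, Finset.sum_sub_distrib] at hcountR harea f1 f2 f3 f4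
  have e : 48 * (J : ℝ) ^ 3 / c = 4 * (12 * J ^ 3 / c) := by ring
  rw [e]
  rw [abs_le] at harea f1 f2 f3 f4 ⊢
  constructor <;>
  linarith [harea.1, harea.2, f1.1, f1.2, f2.1, f2.2, f3.1, f3.2, f4.1, f4.2]

theorem mem_rect_iff {φ w h : ℝ} {p z : ℝ × ℝ} :
    z ∈ rect φ p w h ↔
      (0 ≤ Real.cos φ * (z.1 - p.1) + Real.sin φ * (z.2 - p.2) ∧
        Real.cos φ * (z.1 - p.1) + Real.sin φ * (z.2 - p.2) ≤ w) ∧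
      (0 ≤ Real.cos φ * (z.2 - p.2) - Real.sin φ * (z.1 - p.1) ∧
        Real.cos φ * (z.2 - p.2) - Real.sin φ * (z.1 - p.1) ≤ h) := by
  have hcs := Real.sin_sq_add_cos_sq φ
  constructor
  · rintro ⟨⟨x, y⟩, ⟨hx, hy⟩, rfl⟩
    simp only [rot, Prod.fst_add, Prod.snd_add]
    have e1 : Real.cos φ * (p.1 + (x * Real.cos φ - y * Real.sin φ) - p.1)
        + Real.sin φ * (p.2 + (x * Real.sin φ + y * Real.cos φ) - p.2) = x := by
      linear_combination x * hcs
    have e2 : Real.cos φ * (p.2 + (x * Real.sin φ + y * Real.cos φ) - p.2)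
        - Real.sin φ * (p.1 + (x * Real.cos φ - y * Real.sin φ) - p.1) = y := by
      linear_combination y * hcs
    rw [e1, e2]
    exact ⟨hx, hy⟩
  · rintro ⟨hx, hy⟩
    refine ⟨(_, _), ⟨hx, hy⟩, ?_⟩
    ext
    · simp only [rot, Prod.fst_add]
      linear_combination (z.1 - p.1) * hcs
    · simp only [rot, Prod.snd_add]
      linear_combination (z.2 - p.2) * hcs

theorem volume_rect {w h : ℝ} (φ : ℝ) (p : ℝ × ℝ) (hw : 0 ≤ w) (hh : 0 ≤ h) :
    (volume (rect φ p w h)).toReal = w * h := by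
  let f : ℝ × ℝ →ₗ[ℝ] ℝ × ℝ :=
    Matrix.toLin (Module.Basis.finTwoProd ℝ) (Module.Basis.finTwoProd ℝ)
      !![Real.cos φ, -Real.sin φ; Real.sin φ, Real.cos φ]
  have hf : ∀ x, f x = rot φ x := by
    intro x
    simp only [f, Matrix.toLin_finTwoProd_apply, rot]
    ext <;> simp <;> ring
  have hdet : LinearMap.det f = 1 := by
    rw [LinearMap.det_toLin, Matrix.det_fin_two_of]
    linear_combination Real.sin_sq_add_cos_sq φ
  have himg : rect φ p w h = (fun x => p + x) '' (f '' (Set.Icc 0 w ×ˢ Set.Icc 0 h)) := by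
    rw [Set.image_image]
    simp only [hf, rect]
  rw [himg, Set.image_add_left, measure_preimage_add, Measure.addHaar_image_linearMap, hdet,
    Measure.volume_eq_prod, Measure.prod_prod]
  simp [hw, hh]

theorem ncard_lattice_inter (R : Set (ℝ × ℝ)) :
    (lattice ∩ R).ncard = {z : ℤ × ℤ | ((z.1 : ℝ), (z.2 : ℝ)) ∈ R}.ncard := by
  have hinj : Function.Injective (fun z : ℤ × ℤ => ((z.1 : ℝ), (z.2 : ℝ))) := by
    rintro ⟨x, y⟩ ⟨x', y'⟩ h
    simpa using h
  rw [← Set.ncard_image_of_injective _ hinj]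
  congr 1
  ext z
  constructor
  · rintro ⟨⟨m, n, rfl⟩, hz⟩
    exact ⟨(m, n), hz, rfl⟩
  · rintro ⟨⟨m, n⟩, hz, rfl⟩
    exact ⟨⟨m, n, rfl⟩, hz⟩

theorem abs_fst_le_of_mem_Vsq {α : ℝ} (hα : α ∈ Set.Icc (0 : ℝ) (Real.pi / 2)) {N : ℕ}
    {z : ℝ × ℝ} (hz : z ∈ Vsq α N) : |z.1| ≤ Real.sqrt N := by
  obtain ⟨⟨x, y⟩, ⟨hx, hy⟩, rfl⟩ := hz
  simp only [Set.mem_Ico] at hx hy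
  have hc0 : 0 ≤ Real.cos α := Real.cos_nonneg_of_mem_Icc ⟨by linarith [hα.1, Real.pi_pos], hα.2⟩
  have hs0 : 0 ≤ Real.sin α := Real.sin_nonneg_of_nonneg_of_le_pi hα.1
    (by linarith [hα.2, Real.pi_pos])
  have hc1 := Real.cos_le_one α
  have hs1 := Real.sin_le_one α
  simp only [rot]
  rw [abs_le]
  constructor <;>
  nlinarith [mul_nonneg hx.1 hc0, mul_nonneg hy.1 hs0, mul_nonneg hx.1 (sub_nonneg.mpr hc1),
    mul_nonneg hy.1 (sub_nonneg.mpr hs1)]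

theorem rect_width_le {α : ℝ} (hα : α ∈ Set.Icc (0 : ℝ) (Real.pi / 2)) {N : ℕ} {φ w h : ℝ}
    {p : ℝ × ℝ} (hw : 0 ≤ w) (hh : 0 ≤ h)
    (hsub : rect φ p w h ⊆ Vsq α N) :
    w * Real.cos φ + h * |Real.sin φ| ≤ 2 * Real.sqrt N := by
  have hpt : ∀ x y : ℝ, 0 ≤ x → x ≤ w → 0 ≤ y → y ≤ h →
      |p.1 + (x * Real.cos φ - y * Real.sin φ)| ≤ Real.sqrt N := fun x y h1 h2 h3 h4 =>
    abs_fst_le_of_mem_Vsq hα (hsub ⟨(x, y), ⟨⟨h1, h2⟩, h3, h4⟩, rfl⟩)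
  rcases le_total 0 (Real.sin φ) with hs | hs
  · have h1 := abs_le.mp (hpt w 0 hw le_rfl le_rfl hh)
    have h2 := abs_le.mp (hpt 0 h le_rfl hw hh le_rfl)
    rw [abs_of_nonneg hs]
    linarith [h1.2, h2.1]
  · have h1 := abs_le.mp (hpt w h hw le_rfl hh le_rfl)
    have h2 := abs_le.mp (hpt 0 0 le_rfl hw le_rfl hh)
    rw [abs_of_nonpos hs]
    linarith [h1.2, h2.1]

/-- Discrepancy of a rectangle whose two side directions have diophantine slopes. -/
theorem abs_ncard_rect_sub_area_le {c φ w h : ℝ} {p : ℝ × ℝ} (hc : 0 < c)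
    (hcos : 0 < Real.cos φ) (ht : IsDiophantine c (Real.tan φ))
    (hu : IsDiophantine c (-(Real.tan φ)⁻¹)) (hw : 0 < w) (hh : 0 < h) {J : ℕ} (hJ : 1 ≤ J)
    (hwidth : w * Real.cos φ + h * |Real.sin φ| + 2 < 2 ^ J) :
    |((lattice ∩ rect φ p w h).ncard : ℝ) - w * h| ≤ 48 * J ^ 3 / c + c⁻¹ + 2 := by
  set t := Real.tan φ with htdef
  set C := Real.cos φ with hC
  set S := Real.sin φ with hS
  have htSC : t = S / C := Real.tan_eq_sin_div_cos φ
  have hcs : S ^ 2 + C ^ 2 = 1 := Real.sin_sq_add_cos_sq φ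
  have ht0 : t ≠ 0 := abs_pos.mp (hc.trans ht.lt_abs)
  have hS0 : S ≠ 0 := by rintro h0; apply ht0; rw [htSC, h0, zero_div]
  have htinv : -t⁻¹ = -(C / S) := by rw [htSC, inv_div]
  have hu' := hu.lt_abs
  have hbt : |t| ≤ c⁻¹ := by
    rw [abs_neg, abs_inv] at hu'
    rw [le_inv_comm₀ (abs_pos.mpr ht0) hc]
    exact hu'.le
  have hbu : |-t⁻¹| ≤ c⁻¹ := by
    rw [abs_neg, abs_inv]
    exact inv_anti₀ hc ht.lt_abs.le
  have hbt' := abs_le.mp hbt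
  have hbu' := abs_le.mp hbu
  rw [ncard_lattice_inter]
  rcases lt_or_gt_of_ne hS0 with hneg | hpos
  · have hSC : S * C < 0 := mul_neg_of_neg_of_pos hneg hcos
    have hD : -t⁻¹ - t = -1 / (S * C) := by
      rw [htinv, htSC]; field_simp; linear_combination -hcs
    have hlt : t < -t⁻¹ := by
      have : 0 < -1 / (S * C) := div_pos_of_neg_of_neg (by norm_num) hSC
      linarith
    have hset : {z : ℤ × ℤ | ((z.1 : ℝ), (z.2 : ℝ)) ∈ rect φ p w h}
        = {z : ℤ × ℤ | (p.2 + t⁻¹ * p.1 + w / S ≤ z.2 - -t⁻¹ * z.1 ∧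
            z.2 - -t⁻¹ * z.1 ≤ p.2 + t⁻¹ * p.1) ∧
          (p.2 - t * p.1 ≤ z.2 - t * z.1 ∧ z.2 - t * z.1 ≤ p.2 - t * p.1 + h / C)} := by
      ext ⟨x, y⟩
      simp only [Set.mem_ofPred_eq, mem_rect_iff, ← hC, ← hS]
      have e1 : C * ((x : ℝ) - p.1) + S * (y - p.2)
          = S * (y - -t⁻¹ * x - (p.2 + t⁻¹ * p.1)) := by
        rw [htSC]; field_simp; ring
      have e2 : C * ((y : ℝ) - p.2) - S * (x - p.1) = C * (y - t * x - (p.2 - t * p.1)) := by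
        rw [htSC]; field_simp; ring
      rw [e1, e2]
      refine and_congr ?_ (and_congr ?_ ?_)
      · rw [and_comm]
        refine and_congr ?_ ?_
        · rw [← le_sub_iff_add_le', div_le_iff_of_neg hneg, mul_comm]
        · rw [← sub_nonpos]
          constructor
          · intro h0; by_contra hcon; push Not at hcon; nlinarith
          · intro h0; nlinarith
      · rw [mul_nonneg_iff_of_pos_left hcos, sub_nonneg]
      · rw [← sub_le_iff_le_add', le_div_iff₀ hcos, mul_comm]
    have hwS : w / S < 0 := div_neg_of_pos_of_neg hw hneg
    have hhC : 0 < h / C := div_pos hh hcos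
    have main := abs_ncard_parallelogram_sub_area_le hc hu ht hlt
      (a := p.2 + t⁻¹ * p.1 + w / S) (b := p.2 + t⁻¹ * p.1) (a' := p.2 - t * p.1)
      (b' := p.2 - t * p.1 + h / C) (by linarith) (by linarith) hJ (by
        rw [hD, abs_of_neg hneg] at *
        convert hwidth using 2
        field_simp
        ring)
    have harea : (p.2 + t⁻¹ * p.1 - (p.2 + t⁻¹ * p.1 + w / S))
        * (p.2 - t * p.1 + h / C - (p.2 - t * p.1)) / (-t⁻¹ - t) = w * h := by
      rw [hD]; field_simp; ring
    rw [harea, ← hset] at main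
    refine main.trans ?_
    linarith
  · have hSC : 0 < S * C := mul_pos hpos hcos
    have hD : t - -t⁻¹ = 1 / (S * C) := by
      rw [htinv, htSC]; field_simp; linear_combination hcs
    have hlt : -t⁻¹ < t := by
      have : 0 < 1 / (S * C) := by positivity
      linarith
    have hset : {z : ℤ × ℤ | ((z.1 : ℝ), (z.2 : ℝ)) ∈ rect φ p w h}
        = {z : ℤ × ℤ |
          (p.2 - t * p.1 ≤ z.2 - t * z.1 ∧ z.2 - t * z.1 ≤ p.2 - t * p.1 + h / C) ∧
          (p.2 + t⁻¹ * p.1 ≤ z.2 - -t⁻¹ * z.1 ∧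
            z.2 - -t⁻¹ * z.1 ≤ p.2 + t⁻¹ * p.1 + w / S)} := by
      ext ⟨x, y⟩
      simp only [Set.mem_ofPred_eq, mem_rect_iff, ← hC, ← hS]
      have e1 : C * ((x : ℝ) - p.1) + S * (y - p.2)
          = S * (y - -t⁻¹ * x - (p.2 + t⁻¹ * p.1)) := by
        rw [htSC]; field_simp; ring
      have e2 : C * ((y : ℝ) - p.2) - S * (x - p.1) = C * (y - t * x - (p.2 - t * p.1)) := by
        rw [htSC]; field_simp; ring
      rw [e1, e2, and_comm]
      refine and_congr (and_congr ?_ ?_) (and_congr ?_ ?_)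
      · rw [mul_nonneg_iff_of_pos_left hcos, sub_nonneg]
      · rw [← sub_le_iff_le_add', le_div_iff₀ hcos, mul_comm]
      · rw [mul_nonneg_iff_of_pos_left hpos, sub_nonneg]
      · rw [← sub_le_iff_le_add' (b := p.2 + t⁻¹ * p.1), le_div_iff₀ hpos, mul_comm]
    have hwS : 0 < w / S := div_pos hw hpos
    have hhC : 0 < h / C := div_pos hh hcos
    have main := abs_ncard_parallelogram_sub_area_le hc ht hu hlt
      (a := p.2 - t * p.1) (b := p.2 - t * p.1 + h / C)
      (a' := p.2 + t⁻¹ * p.1) (b' := p.2 + t⁻¹ * p.1 + w / S) (by linarith) (by linarith) hJ (by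
        rw [hD, abs_of_pos hpos] at *
        convert hwidth using 2
        field_simp
        ring)
    have harea : (p.2 - t * p.1 + h / C - (p.2 - t * p.1))
        * (p.2 + t⁻¹ * p.1 + w / S - (p.2 + t⁻¹ * p.1)) / (t - -t⁻¹) = w * h := by
      rw [hD]; field_simp; ring
    rw [harea, ← hset] at main
    refine main.trans ?_
    linarith

theorem tan_sub_pi_div_two_eq_neg_inv (x : ℝ) : Real.tan (x - Real.pi / 2) = -(Real.tan x)⁻¹ := by
  rw [← Real.tan_pi_div_two_sub, ← Real.tan_neg]
  congr 1
  ring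

/-- Let `Ω = {θ n}` be a lacunary sequence in `(0, π/2]` and let `α` satisfy the
diophantine condition `|tan(α - θ) - p/q| > c/(q² (log q)²)` for all
`θ ∈ Ω ∪ {0} ∪ (Ω + π/2) ∪ {π/2}`. Then for every `N ≥ 2` and every rectangle
`R ⊆ V` (the square `[0, √N)²` rotated by `α`) with a side parallel to a side of `V`
or making angle `θ - α` with the x-axis for some `θ ∈ Ω`, the lattice point
discrepancy satisfies `|#(ℤ² ∩ R) - area(R)| ≤ C (log N)³` with `C` independent
of `N` and `R`. -/
theorem lattice_discrepancy_rotated_rectangles_lacunary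
    (θ : ℕ → ℝ) (A : ℝ) (hA0 : 0 < A) (hA1 : A < 1)
    (hθ : ∀ n, θ n ∈ Set.Ioc 0 (Real.pi / 2))
    (hlac : ∀ n, θ (n + 1) ≤ A * θ n)
    (α : ℝ) (hα : α ∈ Set.Icc (0:ℝ) (Real.pi / 2)) (c : ℝ) (hc : 0 < c)
    (hdioph : ∀ θ' : ℝ,
      ((∃ n, θ n = θ') ∨ θ' = 0 ∨ (∃ n, θ n + Real.pi / 2 = θ') ∨ θ' = Real.pi / 2) →
      ∀ (p : ℤ) (q : ℕ), 0 < q →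
        |Real.tan (α - θ') - (p : ℝ) / (q : ℝ)| > c / ((q : ℝ) ^ 2 * (plog q) ^ 2)) :
    ∃ C : ℝ, 0 < C ∧ ∀ N : ℕ, 2 ≤ N →
      ∀ (φ : ℝ) (p : ℝ × ℝ) (w h : ℝ), 0 < w → 0 < h →
        (φ = α ∨ ∃ n, θ n - α = φ) → rect φ p w h ⊆ Vsq α N →
        |((lattice ∩ rect φ p w h).ncard : ℝ) - (volume (rect φ p w h)).toReal|
          ≤ C * (plog N) ^ 3 := by
  refine ⟨6000 / c + c⁻¹ + 2, by positivity, fun N hN φ p w h hw hh hφ hsub => ?_⟩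
  rw [volume_rect φ p hw.le hh.le]
  have hslopes : IsDiophantine c (Real.tan φ) ∧ IsDiophantine c (-(Real.tan φ)⁻¹) := by
    rcases hφ with rfl | ⟨n, rfl⟩
    · constructor
      · intro a b hb
        simpa using hdioph 0 (by simp) a b hb
      · rw [← tan_sub_pi_div_two_eq_neg_inv]
        exact hdioph (Real.pi / 2) (by simp)
    · have hneg : Real.tan (θ n - α) = -Real.tan (α - θ n) := by
        rw [← Real.tan_neg, neg_sub]
      rw [hneg]
      constructor
      · exact IsDiophantine.neg (hdioph (θ n) (Or.inl ⟨n, rfl⟩))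
      · rw [inv_neg, ← tan_sub_pi_div_two_eq_neg_inv, sub_sub]
        exact IsDiophantine.neg (hdioph (θ n + Real.pi / 2) (Or.inr (Or.inr (Or.inl ⟨n, rfl⟩))))
  have hcos0 : 0 ≤ Real.cos φ := by
    apply Real.cos_nonneg_of_mem_Icc
    rcases hφ with rfl | ⟨n, rfl⟩
    · exact ⟨by linarith [hα.1, Real.pi_pos], hα.2⟩
    · exact ⟨by linarith [(hθ n).1, hα.2], by linarith [(hθ n).2, hα.1]⟩
  have hcos : 0 < Real.cos φ := by
    refine hcos0.lt_of_ne fun h0 => ?_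
    have := hslopes.1.lt_abs
    rw [Real.tan_eq_sin_div_cos, ← h0, div_zero, abs_zero] at this
    linarith
  set J := Nat.log 2 N + 4 with hJ
  have hJ1 : 1 ≤ J := by omega
  have hNJ : (2 * N + 2 : ℝ) < 2 ^ J := by
    have h1 : N < 2 ^ (Nat.log 2 N + 1) := Nat.lt_pow_succ_log_self (by norm_num) N
    have h2 : 2 * N + 2 < 2 ^ J := by
      rw [hJ, pow_add]
      rw [pow_add] at h1
      omega
    exact_mod_cast h2
  have hsqrt : Real.sqrt N ≤ N := by
    have : (1 : ℝ) ≤ N := by exact_mod_cast (by omega : 1 ≤ N)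
    rw [Real.sqrt_le_left (by positivity)]
    nlinarith
  have hwidth := rect_width_le hα hw.le hh.le hsub
  refine (abs_ncard_rect_sub_area_le hc hcos hslopes.1 hslopes.2 hw hh hJ1 (by linarith)).trans ?_
  have hlog : (Nat.log 2 N : ℝ) ≤ plog N := by
    refine le_trans ?_ (le_max_right _ _)
    exact_mod_cast Real.natLog_le_logb N 2
  have hpl := one_le_plog N
  have hJpl : (J : ℝ) ≤ 5 * plog N := by
    rw [hJ]; push_cast; linarith
  have hcube : (J : ℝ) ^ 3 ≤ (5 * plog N) ^ 3 := by gcongr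
  have hone : 1 ≤ plog N ^ 3 := one_le_pow₀ hpl
  have hcinv : 0 < c⁻¹ := by positivity
  calc 48 * (J : ℝ) ^ 3 / c + c⁻¹ + 2
      ≤ 48 * (5 * plog N) ^ 3 / c + c⁻¹ * plog N ^ 3 + 2 * plog N ^ 3 := by
        gcongr
        · nlinarith
        · linarith
    _ = (6000 / c + c⁻¹ + 2) * plog N ^ 3 := by ring

end
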